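/- Let Ψ : (0,∞) → ℝ be smooth with ρ Ψ'(ρ) = cos Ψ(ρ) and cos Ψ(ρ) ≠ 0 for all ρ > 0, and let n be the associated 'escape into third dimension' director on Ω = {x ∈ ℝ³ : x₁² + x₂² > 0}, i.e. n = cos Ψ(ρ) e_ρ + sin Ψ(ρ) e_z. If s : Ω → ℝ is smooth and the pair (s, n) satisfies Δs = 3 |∇n|² s + t s − √6 s² + (4/3) s³ and s Δn + 2 (∇s·∇) n + s |∇n|² n = 0 on Ω, then s ≡ 0 on Ω. Hence the escape-into-third-dimension director cannot correspond to a non-trivial purely uniaxial solution of the one-constant Landau–de Gennes Euler–Lagrange equations. -/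

import Mathlib

open Real Set

noncomputable section

/-- Partial derivative in direction `i`. -/
def pd (i : Fin 3) (f : (Fin 3 → ℝ) → ℝ) (x : Fin 3 → ℝ) : ℝ :=
  fderiv ℝ f x (Pi.single i 1)

/-- Laplacian on ℝ³. -/
def lap (f : (Fin 3 → ℝ) → ℝ) (x : Fin 3 → ℝ) : ℝ :=
  ∑ i : Fin 3, pd i (fun y => pd i f y) x

/-- `|∇n|² = Σ_{i,k} (∂_k n_i)²`. -/
def gradSq (n : (Fin 3 → ℝ) → Fin 3 → ℝ) (x : Fin 3 → ℝ) : ℝ :=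
  ∑ i : Fin 3, ∑ k : Fin 3, (pd k (fun y => n y i) x) ^ 2

/-- Cylindrical radius `ρ = √(x₁² + x₂²)`. -/
def cylRad (x : Fin 3 → ℝ) : ℝ := Real.sqrt (x 0 ^ 2 + x 1 ^ 2)

/-- The "escape into third dimension" director
`n = cos Ψ(ρ) e_ρ + sin Ψ(ρ) e_z`. -/
def escDir (Ψ : ℝ → ℝ) (x : Fin 3 → ℝ) : Fin 3 → ℝ :=
  ![Real.cos (Ψ (cylRad x)) * (x 0 / cylRad x),
    Real.cos (Ψ (cylRad x)) * (x 1 / cylRad x),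
    Real.sin (Ψ (cylRad x))]

/-- `f` is differentiable at `x`, with `k`-th partial derivative `f'`. -/
def HasPD (k : Fin 3) (f : (Fin 3 → ℝ) → ℝ) (f' : ℝ) (x : Fin 3 → ℝ) : Prop :=
  DifferentiableAt ℝ f x ∧ pd k f x = f'

namespace HasPD

variable {k : Fin 3} {f g : (Fin 3 → ℝ) → ℝ} {f' g' : ℝ} {x : Fin 3 → ℝ}

lemma const (k : Fin 3) (c : ℝ) (x : Fin 3 → ℝ) : HasPD k (fun _ => c) 0 x :=
  ⟨by fun_prop, by simp [pd]⟩

lemma coord (k i : Fin 3) (x : Fin 3 → ℝ) :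
    HasPD k (fun y => y i) (if i = k then 1 else 0) x := by
  refine ⟨by fun_prop, ?_⟩
  have h : HasFDerivAt (fun y : Fin 3 → ℝ => y i)
      (ContinuousLinearMap.proj (R := ℝ) (φ := fun _ : Fin 3 => ℝ) i) x :=
    (ContinuousLinearMap.proj (R := ℝ) (φ := fun _ : Fin 3 => ℝ) i).hasFDerivAt
  rw [pd, h.fderiv]
  simp [Pi.single_apply]

lemma add (hf : HasPD k f f' x) (hg : HasPD k g g' x) :
    HasPD k (fun y => f y + g y) (f' + g') x := by
  refine ⟨hf.1.add hg.1, ?_⟩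
  rw [← hf.2, ← hg.2, pd, fderiv_fun_add hf.1 hg.1]
  rfl

lemma mul (hf : HasPD k f f' x) (hg : HasPD k g g' x) :
    HasPD k (fun y => f y * g y) (f' * g x + f x * g') x := by
  refine ⟨hf.1.mul hg.1, ?_⟩
  rw [← hf.2, ← hg.2, pd, fderiv_fun_mul hf.1 hg.1]
  simp [pd]
  ring

lemma comp {φ : ℝ → ℝ} {φ' : ℝ} (hφ : HasDerivAt φ φ' (f x)) (hf : HasPD k f f' x) :
    HasPD k (fun y => φ (f y)) (φ' * f') x := by
  have h := hφ.comp_hasFDerivAt x hf.1.hasFDerivAt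
  refine ⟨h.differentiableAt, ?_⟩
  rw [← hf.2, pd]
  exact congrArg (· (Pi.single k 1)) h.fderiv

lemma congr (hf : HasPD k f f' x) (h : g =ᶠ[nhds x] f) : HasPD k g f' x :=
  ⟨hf.1.congr_of_eventuallyEq h, by rw [pd, h.fderiv_eq]; exact hf.2⟩

end HasPD

lemma isOpen_cylDomain : IsOpen {x : Fin 3 → ℝ | x 0 ^ 2 + x 1 ^ 2 > 0} :=
  isOpen_lt continuous_const (by fun_prop)

lemma cylRad_sq (x : Fin 3 → ℝ) : cylRad x ^ 2 = x 0 ^ 2 + x 1 ^ 2 :=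
  Real.sq_sqrt (by positivity)

lemma cylRad_pos {x : Fin 3 → ℝ} (hx : x 0 ^ 2 + x 1 ^ 2 > 0) : 0 < cylRad x :=
  Real.sqrt_pos.2 hx

/-- The horizontal projection of `x`. -/
def horiz (x : Fin 3 → ℝ) : Fin 3 → ℝ := ![x 0, x 1, 0]

lemma hasPD_horiz (k j : Fin 3) (x : Fin 3 → ℝ) :
    HasPD k (fun y => horiz y j) (if j = k ∧ j ≠ 2 then 1 else 0) x := by
  fin_cases j
  · simpa [horiz] using HasPD.coord k 0 x
  · simpa [horiz] using HasPD.coord k 1 x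
  · simpa [horiz] using HasPD.const k 0 x

lemma hasPD_cylRad (k : Fin 3) {x : Fin 3 → ℝ} (hx : x 0 ^ 2 + x 1 ^ 2 > 0) :
    HasPD k cylRad (horiz x k / cylRad x) x := by
  have h0 := HasPD.coord k 0 x
  have h1 := HasPD.coord k 1 x
  have h := HasPD.comp (Real.hasDerivAt_sqrt (x := x 0 * x 0 + x 1 * x 1) (by nlinarith))
    ((h0.mul h0).add (h1.mul h1))
  have e : cylRad = fun y => √(y 0 * y 0 + y 1 * y 1) := by
    funext y; simp only [cylRad, pow_two]
  rw [e]
  convert h using 1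
  have : 0 < √(x 0 * x 0 + x 1 * x 1) := Real.sqrt_pos.2 (by nlinarith)
  fin_cases k <;> simp [horiz] <;> field_simp <;> ring

lemma hasPD_sin {Ψ : ℝ → ℝ} (hΨ : ∀ ρ : ℝ, 0 < ρ → HasDerivAt Ψ (Real.cos (Ψ ρ) / ρ) ρ)
    (k : Fin 3) {x : Fin 3 → ℝ} (hx : x 0 ^ 2 + x 1 ^ 2 > 0) :
    HasPD k (fun y => Real.sin (Ψ (cylRad y)))
      (Real.cos (Ψ (cylRad x)) ^ 2 * horiz x k * (cylRad x)⁻¹ * (cylRad x)⁻¹) x := by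
  convert HasPD.comp (hΨ _ (cylRad_pos hx)).sin (hasPD_cylRad k hx) using 1
  ring

lemma hasPD_cos {Ψ : ℝ → ℝ} (hΨ : ∀ ρ : ℝ, 0 < ρ → HasDerivAt Ψ (Real.cos (Ψ ρ) / ρ) ρ)
    (k : Fin 3) {x : Fin 3 → ℝ} (hx : x 0 ^ 2 + x 1 ^ 2 > 0) :
    HasPD k (fun y => Real.cos (Ψ (cylRad y)))
      (-Real.sin (Ψ (cylRad x)) * Real.cos (Ψ (cylRad x)) * horiz x k
        * (cylRad x)⁻¹ * (cylRad x)⁻¹) x := by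
  convert HasPD.comp (hΨ _ (cylRad_pos hx)).cos (hasPD_cylRad k hx) using 1
  ring

lemma hasPD_cylRad_inv (k : Fin 3) {x : Fin 3 → ℝ} (hx : x 0 ^ 2 + x 1 ^ 2 > 0) :
    HasPD k (fun y => (cylRad y)⁻¹)
      (-horiz x k * (cylRad x)⁻¹ * (cylRad x)⁻¹ * (cylRad x)⁻¹) x := by
  convert HasPD.comp (hasDerivAt_inv (cylRad_pos hx).ne') (hasPD_cylRad k hx) using 1
  ring

/-- The `k`-th partial derivative of the `i`-th component of `escDir Ψ`, for `Ψ` solving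
`ρ Ψ' = cos Ψ`. -/
def escDirPD (Ψ : ℝ → ℝ) (k i : Fin 3) (x : Fin 3 → ℝ) : ℝ :=
  if i = 2 then Real.cos (Ψ (cylRad x)) * Real.cos (Ψ (cylRad x)) * horiz x k
      * (cylRad x)⁻¹ * (cylRad x)⁻¹
  else (if i = k then 1 else 0) * (Real.cos (Ψ (cylRad x)) * (cylRad x)⁻¹)
    + -1 * (Real.sin (Ψ (cylRad x)) + 1) * Real.cos (Ψ (cylRad x)) * horiz x i * horiz x k
      * (cylRad x)⁻¹ * (cylRad x)⁻¹ * (cylRad x)⁻¹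

lemma hasPD_escDir {Ψ : ℝ → ℝ} (hΨ : ∀ ρ : ℝ, 0 < ρ → HasDerivAt Ψ (Real.cos (Ψ ρ) / ρ) ρ)
    (k i : Fin 3) {x : Fin 3 → ℝ} (hx : x 0 ^ 2 + x 1 ^ 2 > 0) :
    HasPD k (fun y => escDir Ψ y i) (escDirPD Ψ k i x) x := by
  have hr := hasPD_cylRad_inv k hx
  have hc := hasPD_cos hΨ k hx
  obtain rfl | rfl | rfl : i = 0 ∨ i = 1 ∨ i = 2 := by omega
  · convert hc.mul ((HasPD.coord k 0 x).mul hr) using 1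
    · funext y
      simp [escDir, div_eq_mul_inv]
    · simp [escDirPD, horiz]
      split_ifs <;> ring
  · convert hc.mul ((HasPD.coord k 1 x).mul hr) using 1
    · funext y
      simp [escDir, div_eq_mul_inv]
    · simp [escDirPD, horiz]
      split_ifs <;> ring
  · convert hasPD_sin hΨ k hx using 1
    · funext y
      simp [escDir]
    · simp [escDirPD, pow_two]

lemma lap_escDir {Ψ : ℝ → ℝ} (hΨ : ∀ ρ : ℝ, 0 < ρ → HasDerivAt Ψ (Real.cos (Ψ ρ) / ρ) ρ)
    (i : Fin 3) {x : Fin 3 → ℝ} (hx : x 0 ^ 2 + x 1 ^ 2 > 0) :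
    lap (fun y => escDir Ψ y i) x =
      -(2 * Real.cos (Ψ (cylRad x)) ^ 2 / cylRad x ^ 2) * escDir Ψ x i := by
  have hr0 := cylRad_pos hx
  have hr2 := cylRad_sq x
  have hsc := Real.sin_sq_add_cos_sq (Ψ (cylRad x))
  have key : ∀ k d, HasPD k (escDirPD Ψ k i) d x →
      pd k (fun y => pd k (fun z => escDir Ψ z i) y) x = d := fun k d h =>
    (h.congr (Filter.eventually_of_mem (isOpen_cylDomain.mem_nhds hx)
      fun y hy => (hasPD_escDir hΨ k i hy).2)).2
  have hr := fun k => hasPD_cylRad_inv k hx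
  have hc := fun k => hasPD_cos hΨ k hx
  have hs := fun k => hasPD_sin hΨ k hx
  by_cases hi : i = 2
  · have h := fun k => key k _
      ((((((hc k).mul (hc k)).mul (hasPD_horiz k k x)).mul (hr k)).mul (hr k)).congr
        (Filter.Eventually.of_forall fun y => by simp only [escDirPD, hi, if_true]))
    simp only [lap, Fin.sum_univ_three, h]
    subst hi
    generalize hR : cylRad x = R at *
    simp only [escDir, hR]
    generalize Real.cos (Ψ R) = C at *
    generalize Real.sin (Ψ R) = S at *
    simp [horiz]
    field_simp
    linear_combination 2 * C ^ 2 * (S + 1) * hr2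
  · have h := fun k => key k _ ((((HasPD.const k (if i = k then 1 else 0) x).mul ((hc k).mul (hr k))).add
        ((((((((HasPD.const k (-1) x).mul ((hs k).add (HasPD.const k 1 x))).mul (hc k)).mul
          (hasPD_horiz k i x)).mul (hasPD_horiz k k x)).mul (hr k)).mul (hr k)).mul (hr k))).congr
        (Filter.Eventually.of_forall fun y => by simp only [escDirPD, hi, if_false]))
    simp only [lap, Fin.sum_univ_three, h]
    generalize hR : cylRad x = R at *
    simp only [escDir, hR]
    generalize Real.cos (Ψ R) = C at *
    generalize Real.sin (Ψ R) = S at *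
    obtain rfl | rfl | rfl : i = 0 ∨ i = 1 ∨ i = 2 := by omega
    · simp [horiz]
      field_simp
      linear_combination C * x 0 * R ^ 2 * hsc
        - C * x 0 * (-C ^ 2 + S * (1 + S) + 3 * (1 + S)) * hr2
    · simp [horiz]
      field_simp
      linear_combination C * x 1 * R ^ 2 * hsc
        - C * x 1 * (-C ^ 2 + S * (1 + S) + 3 * (1 + S)) * hr2
    · exact absurd rfl hi

lemma gradSq_escDir {Ψ : ℝ → ℝ} (hΨ : ∀ ρ : ℝ, 0 < ρ → HasDerivAt Ψ (Real.cos (Ψ ρ) / ρ) ρ)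
    {x : Fin 3 → ℝ} (hx : x 0 ^ 2 + x 1 ^ 2 > 0) :
    gradSq (escDir Ψ) x = 2 * Real.cos (Ψ (cylRad x)) ^ 2 / cylRad x ^ 2 := by
  have hr0 := cylRad_pos hx
  have hr2 := cylRad_sq x
  have hsc := Real.sin_sq_add_cos_sq (Ψ (cylRad x))
  have h := fun k i => (hasPD_escDir hΨ k i hx).2
  simp only [gradSq, Fin.sum_univ_three, h]
  simp only [escDirPD]
  generalize hR : cylRad x = R at *
  generalize Real.cos (Ψ R) = C at *
  generalize Real.sin (Ψ R) = S at *
  simp [horiz]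
  field_simp
  linear_combination C ^ 2 * R ^ 4 * hsc - C ^ 2 * (-2 * (1 + S) * R ^ 2
    + (1 + S) ^ 2 * (x 0 ^ 2 + x 1 ^ 2 + R ^ 2) + C ^ 2 * R ^ 2) * hr2

lemma pd_eq_zero_of_transport {Ψ : ℝ → ℝ}
    (hΨ : ∀ ρ : ℝ, 0 < ρ → HasDerivAt Ψ (Real.cos (Ψ ρ) / ρ) ρ)
    (hcos : ∀ ρ : ℝ, 0 < ρ → Real.cos (Ψ ρ) ≠ 0) (s : (Fin 3 → ℝ) → ℝ)
    {x : Fin 3 → ℝ} (hx : x 0 ^ 2 + x 1 ^ 2 > 0)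
    (h : ∀ i, ∑ k : Fin 3, pd k s x * pd k (fun y => escDir Ψ y i) x = 0) :
    pd 0 s x = 0 ∧ pd 1 s x = 0 := by
  have hr0 := (cylRad_pos hx).ne'
  have hc := hcos _ (cylRad_pos hx)
  have hp := fun k i => (hasPD_escDir hΨ k i hx).2
  simp only [Fin.sum_univ_three, hp] at h
  have h0 := h 0
  have h1 := h 1
  have h2 := h 2
  simp only [escDirPD] at h0 h1 h2
  generalize cylRad x = R at *
  generalize Real.cos (Ψ R) = C at *
  generalize Real.sin (Ψ R) = S at *
  simp [horiz] at h0 h1 h2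
  have e : x 0 * pd 0 s x + x 1 * pd 1 s x = 0 := by
    have : C ^ 2 * R⁻¹ ^ 2 * (x 0 * pd 0 s x + x 1 * pd 1 s x) = 0 := by linear_combination h2
    simpa [hc, hr0] using this
  constructor
  · have : C * R⁻¹ * pd 0 s x = 0 := by
      linear_combination h0 + (S + 1) * C * x 0 * R⁻¹ ^ 3 * e
    simpa [hc, hr0] using this
  · have : C * R⁻¹ * pd 1 s x = 0 := by
      linear_combination h1 + (S + 1) * C * x 1 * R⁻¹ ^ 3 * e
    simpa [hc, hr0] using this

lemma lap_congr {f g : (Fin 3 → ℝ) → ℝ} {x : Fin 3 → ℝ} (h : f =ᶠ[nhds x] g) :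
    lap f x = lap g x := by
  unfold lap pd
  refine Finset.sum_congr rfl fun i _ => ?_
  have : (fun y => fderiv ℝ f y (Pi.single i 1)) =ᶠ[nhds x]
      fun y => fderiv ℝ g y (Pi.single i 1) :=
    (h.fderiv (𝕜 := ℝ)).mono fun y hy => by simp only [hy]
  rw [this.fderiv_eq]

lemma lap_comp_add_right (f : (Fin 3 → ℝ) → ℝ) (a x : Fin 3 → ℝ) :
    lap (fun y => f (y + a)) x = lap f (x + a) := by
  unfold lap pd
  refine Finset.sum_congr rfl fun i _ => ?_
  simp only [fderiv_comp_add_right]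
  rw [fderiv_comp_add_right (f := fun y => fderiv ℝ f y (Pi.single i 1))]

/-- A function whose horizontal derivatives vanish is invariant under horizontal translations,
as long as the translated segment stays in the domain. -/
lemma eq_add_smul_horiz {s : (Fin 3 → ℝ) → ℝ}
    (hd : ∀ x : Fin 3 → ℝ, x 0 ^ 2 + x 1 ^ 2 > 0 → DifferentiableAt ℝ s x)
    (hp : ∀ x : Fin 3 → ℝ, x 0 ^ 2 + x 1 ^ 2 > 0 → pd 0 s x = 0 ∧ pd 1 s x = 0)
    {x y : Fin 3 → ℝ} (hxy : 0 < x 0 * y 0 + x 1 * y 1) {μ : ℝ} (hμ : 0 ≤ μ) :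
    s (y + μ • horiz x) = s y := by
  have hmem : ∀ τ : ℝ, 0 ≤ τ →
      (y + τ • horiz x) 0 ^ 2 + (y + τ • horiz x) 1 ^ 2 > 0 := by
    intro τ hτ
    simp only [horiz, Pi.add_apply, Pi.smul_apply, smul_eq_mul, Matrix.cons_val_zero,
      Matrix.cons_val_one]
    have hy : 0 < y 0 ^ 2 + y 1 ^ 2 := by
      by_contra! hle
      have h0 : y 0 = 0 := by nlinarith [sq_nonneg (y 0), sq_nonneg (y 1)]
      have h1 : y 1 = 0 := by nlinarith [sq_nonneg (y 0), sq_nonneg (y 1)]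
      simp [h0, h1] at hxy
    nlinarith [mul_nonneg hτ hxy.le, sq_nonneg (τ * x 0), sq_nonneg (τ * x 1)]
  have hder : ∀ τ : ℝ, 0 ≤ τ → HasDerivAt (fun τ : ℝ => s (y + τ • horiz x)) 0 τ := by
    intro τ hτ
    have h1 : HasDerivAt (fun τ : ℝ => y + τ • horiz x) (horiz x) τ := by
      simpa using ((hasDerivAt_id τ).smul_const (horiz x)).const_add y
    have h2 := (hd _ (hmem τ hτ)).hasFDerivAt.comp_hasDerivAt τ h1
    have e : horiz x = x 0 • Pi.single 0 1 + x 1 • Pi.single 1 1 := by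
      ext i; fin_cases i <;> simp [horiz]
    obtain ⟨p0, p1⟩ := hp _ (hmem τ hτ)
    unfold pd at p0 p1
    have h3 : fderiv ℝ s (y + τ • horiz x) (horiz x) = 0 := by
      generalize fderiv ℝ s (y + τ • horiz x) = D at *
      rw [e, map_add, map_smul, map_smul, p0, p1]
      simp
    rwa [h3] at h2
  have := constant_of_has_deriv_right_zero (a := 0) (b := μ)
    (fun τ hτ => (hder τ hτ.1).continuousAt.continuousWithinAt)
    (fun τ hτ => (hder τ hτ.1).hasDerivWithinAt) μ ⟨hμ, le_rfl⟩
  simpa using this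

/-- the escape-into-third-dimension director cannot correspond to a
non-trivial purely uniaxial solution of the one-constant LdG Euler–Lagrange equations:
if the pair `(s, n)` with `n = cos Ψ(ρ) e_ρ + sin Ψ(ρ) e_z` satisfies the uniaxial
system on `Ω = {x : x₁² + x₂² > 0}`, then `s ≡ 0` on Ω. -/
theorem stmt7 (t : ℝ) (Ψ : ℝ → ℝ)
    (hΨ : ContDiffOn ℝ (⊤ : ℕ∞) Ψ (Ioi 0))
    (hODE : ∀ ρ : ℝ, 0 < ρ → ρ * deriv Ψ ρ = Real.cos (Ψ ρ))
    (hcos : ∀ ρ : ℝ, 0 < ρ → Real.cos (Ψ ρ) ≠ 0)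
    (Ω : Set (Fin 3 → ℝ)) (hΩdef : Ω = {x : Fin 3 → ℝ | x 0 ^ 2 + x 1 ^ 2 > 0})
    (s : (Fin 3 → ℝ) → ℝ) (hs : ContDiffOn ℝ (⊤ : ℕ∞) s Ω)
    (heq1 : ∀ x ∈ Ω,
      lap s x = 3 * gradSq (escDir Ψ) x * s x
        + t * s x - Real.sqrt 6 * s x ^ 2 + (4/3) * s x ^ 3)
    (heq2 : ∀ x ∈ Ω, ∀ i : Fin 3,
      s x * lap (fun y => escDir Ψ y i) x
        + 2 * (∑ k : Fin 3, pd k s x * pd k (fun y => escDir Ψ y i) x)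
        + s x * gradSq (escDir Ψ) x * escDir Ψ x i = 0) :
    ∀ x ∈ Ω, s x = 0 := by
  subst hΩdef
  have hΨ' : ∀ ρ : ℝ, 0 < ρ → HasDerivAt Ψ (Real.cos (Ψ ρ) / ρ) ρ := by
    intro ρ hρ
    have h := ((hΨ.contDiffAt (Ioi_mem_nhds hρ)).differentiableAt (by simp)).hasDerivAt
    rwa [← hODE ρ hρ, mul_div_cancel_left₀ _ hρ.ne']
  have hd : ∀ x : Fin 3 → ℝ, x 0 ^ 2 + x 1 ^ 2 > 0 → DifferentiableAt ℝ s x := fun x hx =>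
    (hs.contDiffAt (isOpen_cylDomain.mem_nhds hx)).differentiableAt (by simp)
  have hp : ∀ x : Fin 3 → ℝ, x 0 ^ 2 + x 1 ^ 2 > 0 → pd 0 s x = 0 ∧ pd 1 s x = 0 := by
    refine fun x hx => pd_eq_zero_of_transport hΨ' hcos s hx fun i => ?_
    have h := heq2 x hx i
    rw [lap_escDir hΨ' i hx, gradSq_escDir hΨ' hx] at h
    linear_combination h / 2
  intro x hx
  have hx' : x 0 ^ 2 + x 1 ^ 2 > 0 := hx
  by_contra hsx
  set C := Real.cos (Ψ (cylRad x)) with hC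
  have hC0 : C ≠ 0 := hcos _ (cylRad_pos hx)
  set μ := (C ^ 2)⁻¹ with hμ
  have hμ0 : 0 < μ := by positivity
  have hμC : μ * C ^ 2 = 1 := inv_mul_cancel₀ (by positivity)
  have hrad : (x + μ • horiz x) 0 ^ 2 + (x + μ • horiz x) 1 ^ 2
      = (1 + μ) ^ 2 * (x 0 ^ 2 + x 1 ^ 2) := by
    simp [horiz]
    ring
  have hxa : (x + μ • horiz x) 0 ^ 2 + (x + μ • horiz x) 1 ^ 2 > 0 := by
    rw [hrad]
    positivity
  have hsa : s (x + μ • horiz x) = s x :=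
    eq_add_smul_horiz hd hp (by nlinarith) hμ0.le
  have hlap : lap s (x + μ • horiz x) = lap s x := by
    rw [← lap_comp_add_right]
    refine lap_congr ?_
    have hU : IsOpen {y : Fin 3 → ℝ | 0 < x 0 * y 0 + x 1 * y 1} :=
      isOpen_lt continuous_const (by fun_prop)
    have hxU : x ∈ {y : Fin 3 → ℝ | 0 < x 0 * y 0 + x 1 * y 1} := by
      show 0 < x 0 * x 0 + x 1 * x 1
      nlinarith
    filter_upwards [hU.mem_nhds hxU] with y hy
    exact eq_add_smul_horiz hd hp hy hμ0.le
  have e1 := heq1 x hx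
  have e2 := heq1 _ hxa
  rw [hlap, hsa, e1] at e2
  have hg : gradSq (escDir Ψ) x = gradSq (escDir Ψ) (x + μ • horiz x) :=
    mul_right_cancel₀ hsx (by linear_combination e2 / 3)
  rw [gradSq_escDir hΨ' hx, gradSq_escDir hΨ' hxa, cylRad_sq, cylRad_sq, hrad, ← hC] at hg
  have hle := Real.cos_sq_le_one (Ψ (cylRad (x + μ • horiz x)))
  have hμ1 : 0 < 1 + μ := by positivity
  field_simp at hg
  nlinarith [mul_pos hμ0 hμ0, sq_nonneg C, mul_pos hμ0 (sq_pos_of_ne_zero hC0)]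

end
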